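/- For every a ∈ ℝ, ∫ e^{2πi a t} dν(t) = ∏_{m=1}^∞ (1 - 2(1-p_m) sin²(3^{-m} π a)), where the infinite product converges. -/

import Mathlib

open MeasureTheory Filter
open scoped ENNReal

noncomputable section

/-- The `n`-th factor measure `((1-pₙ)/2)·δ₋₁ + pₙ·δ₀ + ((1-pₙ)/2)·δ₁` on `ℝ`. -/
def cantorFactor (p : ℕ → ℝ) (n : ℕ) : Measure ℝ :=
  ENNReal.ofReal ((1 - p n) / 2) • Measure.dirac (-1 : ℝ)
    + ENNReal.ofReal (p n) • Measure.dirac (0 : ℝ)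
    + ENNReal.ofReal ((1 - p n) / 2) • Measure.dirac (1 : ℝ)

/-- `θ(x) = ∑_{n=1}^∞ 3⁻ⁿ xₙ`. -/
def cantorCoord (x : ℕ → ℝ) : ℝ := ∑' n : ℕ, ((3 : ℝ)⁻¹) ^ (n + 1) * x (n + 1)

/-- `ζ` is the product probability measure on `{-1,0,1}^{ℕ≥1}` (viewed inside `ℕ → ℝ`)
whose `n`-th factor (`n ≥ 1`) is `cantorFactor p n`; we characterize it by its values
on cylinder sets over coordinates `n ≥ 1`. -/
def IsCantorProductMeasure (p : ℕ → ℝ) (ζ : Measure (ℕ → ℝ)) : Prop :=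
  IsProbabilityMeasure ζ ∧
    ∀ s : Finset ℕ, (∀ n ∈ s, 1 ≤ n) →
      ∀ B : ℕ → Set ℝ, (∀ n, MeasurableSet (B n)) →
        ζ {x | ∀ n ∈ s, x n ∈ B n} = ∏ n ∈ s, cantorFactor p n (B n)

/-- `r_m = 3^{2m} p₁ ⋯ p_{m-1} (1 - p_m)`. -/
def cantorR (p : ℕ → ℝ) (m : ℕ) : ℝ :=
  (3 : ℝ) ^ (2 * m) * (∏ k ∈ Finset.Ico 1 m, p k) * (1 - p m)

end

lemma IsCantorProductMeasure.map_eval {p : ℕ → ℝ} {ζ : Measure (ℕ → ℝ)}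
    (hζ : IsCantorProductMeasure p ζ) {n : ℕ} (hn : 1 ≤ n) :
    ζ.map (fun x => x n) = cantorFactor p n := by
  ext B hB
  rw [Measure.map_apply (measurable_pi_apply n) hB]
  simpa [Set.preimage] using hζ.2 {n} (by simpa using hn) (fun _ => B) (fun _ => hB)

open ProbabilityTheory in
lemma IsCantorProductMeasure.iIndepFun_eval {p : ℕ → ℝ} {ζ : Measure (ℕ → ℝ)}
    (hζ : IsCantorProductMeasure p ζ) :
    iIndepFun (fun (n : ℕ) (x : ℕ → ℝ) => x (n + 1)) ζ := by
  classical
  rw [iIndepFun_iff_measure_inter_preimage_eq_mul]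
  intro S B hB
  have key := hζ.2 (S.image (· + 1)) (by simp)
    (fun n => if n - 1 ∈ S then B (n - 1) else ∅)
    (fun n => by split_ifs with h; exacts [hB _ h, MeasurableSet.empty])
  rw [Finset.prod_image (by simp)] at key
  have hset : (⋂ i ∈ S, (fun x : ℕ → ℝ => x (i + 1)) ⁻¹' B i) =
      {x | ∀ n ∈ S.image (· + 1), x n ∈ (if n - 1 ∈ S then B (n - 1) else ∅)} := by
    ext x
    simp +contextual
  rw [hset, key]
  refine Finset.prod_congr rfl fun n hn => ?_
  rw [← hζ.map_eval (Nat.le_add_left 1 n)]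
  simp only [Nat.add_sub_cancel, hn, if_true]
  exact Measure.map_apply (measurable_pi_apply _) (hB n hn)

lemma IsCantorProductMeasure.ae_abs_le_one {p : ℕ → ℝ} {ζ : Measure (ℕ → ℝ)}
    (hζ : IsCantorProductMeasure p ζ) : ∀ᵐ x ∂ζ, ∀ n : ℕ, |x (n + 1)| ≤ 1 := by
  rw [ae_all_iff]
  intro n
  have h : ∀ᵐ t ∂(ζ.map (fun x => x (n + 1))), |t| ≤ 1 := by
    rw [hζ.map_eval (Nat.le_add_left 1 n), cantorFactor]
    simp only [ae_add_measure_iff]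
    refine ⟨⟨?_, ?_⟩, ?_⟩ <;> refine Measure.ae_smul_measure ?_ _ <;> simp [ae_dirac_eq]
  exact ae_of_ae_map (measurable_pi_apply _).aemeasurable h

lemma tendsto_sum_cantorCoord {x : ℕ → ℝ} (hx : ∀ n : ℕ, |x (n + 1)| ≤ 1) :
    Tendsto (fun N => ∑ n ∈ Finset.range N, ((3 : ℝ)⁻¹) ^ (n + 1) * x (n + 1)) atTop
      (nhds (cantorCoord x)) := by
  refine (Summable.of_norm_bounded (g := fun n : ℕ => ((3 : ℝ)⁻¹) ^ (n + 1)) ?_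
    fun n => ?_).hasSum.tendsto_sum_nat
  · exact (summable_nat_add_iff 1).2 (summable_geometric_of_lt_one (by norm_num) (by norm_num))
  · rw [norm_mul, Real.norm_of_nonneg (by positivity)]
    exact mul_le_of_le_one_right (by positivity) (hx n)

lemma IsCantorProductMeasure.aemeasurable_cantorCoord {p : ℕ → ℝ} {ζ : Measure (ℕ → ℝ)}
    (hζ : IsCantorProductMeasure p ζ) : AEMeasurable cantorCoord ζ := by
  refine aemeasurable_of_tendsto_metrizable_ae atTop
    (f := fun N x => ∑ n ∈ Finset.range N, ((3 : ℝ)⁻¹) ^ (n + 1) * x (n + 1))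
    (fun N => Measurable.aemeasurable (by fun_prop)) ?_
  filter_upwards [hζ.ae_abs_le_one] with x hx using tendsto_sum_cantorCoord hx

lemma integral_cexp_cantorFactor {p : ℕ → ℝ} {n : ℕ} (hp : 0 ≤ p n ∧ p n ≤ 1) (b : ℝ) :
    ∫ t, Complex.exp (2 * Complex.I * b * t) ∂(cantorFactor p n)
      = ((1 - 2 * (1 - p n) * Real.sin b ^ 2 : ℝ) : ℂ) := by
  have hi (c : ℝ) (t : ℝ) : Integrable (fun t : ℝ => Complex.exp (2 * Complex.I * b * t))
      (ENNReal.ofReal c • Measure.dirac t) :=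
    (integrable_dirac (by simp)).smul_measure ENNReal.ofReal_ne_top
  have hq : 0 ≤ (1 - p n) / 2 := by linarith [hp.2]
  rw [cantorFactor, integral_add_measure ((hi _ _).add_measure (hi _ _)) (hi _ _),
    integral_add_measure (hi _ _) (hi _ _)]
  simp only [integral_smul_measure, integral_dirac, ENNReal.toReal_ofReal hq,
    ENNReal.toReal_ofReal hp.1, Complex.real_smul]
  have hcos := Complex.two_cos (2 * (b : ℂ))
  rw [Complex.cos_two_mul, Complex.cos_sq'] at hcos
  have h1 : 2 * Complex.I * b * ((1 : ℝ) : ℂ) = 2 * b * Complex.I := by push_cast; ring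
  have h2 : 2 * Complex.I * b * ((-1 : ℝ) : ℂ) = -(2 * b) * Complex.I := by push_cast; ring
  rw [h1, h2]
  push_cast
  simp only [mul_zero, Complex.exp_zero]
  linear_combination (-(1 - (p n : ℂ)) / 2) * hcos

lemma multipliable_one_sub_sin_sq {p : ℕ → ℝ} (hp : ∀ n, 1 ≤ n → 0 ≤ p n ∧ p n ≤ 1) (a : ℝ) :
    Multipliable (fun m : ℕ =>
      1 - 2 * (1 - p (m + 1)) * Real.sin (((3 : ℝ) ^ (m + 1))⁻¹ * Real.pi * a) ^ 2) := by
  simp only [sub_eq_add_neg (1 : ℝ) (2 * _ * _)]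
  refine Real.multipliable_one_add_of_summable (Summable.of_norm_bounded
    (g := fun m : ℕ => 2 * (Real.pi * |a|) * ((3 : ℝ)⁻¹) ^ (m + 1)) ?_ fun m => ?_)
  · exact ((summable_nat_add_iff 1).2
      (summable_geometric_of_lt_one (by norm_num) (by norm_num))).mul_left _
  · obtain ⟨h0, h1⟩ := hp (m + 1) (Nat.le_add_left 1 m)
    set b := ((3 : ℝ) ^ (m + 1))⁻¹ * Real.pi * a with hb
    have hbabs : |b| = Real.pi * |a| * ((3 : ℝ)⁻¹) ^ (m + 1) := by
      rw [hb, abs_mul, abs_of_nonneg (by positivity), inv_pow]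
      ring
    have hsin : Real.sin b ^ 2 ≤ |b| := by
      rw [← sq_abs]
      nlinarith [Real.abs_sin_le_one b, Real.abs_sin_le_abs (x := b), abs_nonneg (Real.sin b)]
    rw [norm_neg, Real.norm_of_nonneg (mul_nonneg (by linarith) (sq_nonneg _))]
    nlinarith [sq_nonneg (Real.sin b)]

lemma IsCantorProductMeasure.integral_cexp_sum {p : ℕ → ℝ} {ζ : Measure (ℕ → ℝ)}
    (hζ : IsCantorProductMeasure p ζ) (hp : ∀ n, 1 ≤ n → 0 ≤ p n ∧ p n ≤ 1) (a : ℝ) (N : ℕ) :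
    ∫ x, Complex.exp (2 * (Real.pi : ℂ) * Complex.I * (a : ℂ) *
        ((∑ n ∈ Finset.range N, ((3 : ℝ)⁻¹) ^ (n + 1) * x (n + 1) : ℝ) : ℂ)) ∂ζ
      = ((∏ m ∈ Finset.range N,
          (1 - 2 * (1 - p (m + 1)) * Real.sin (((3 : ℝ) ^ (m + 1))⁻¹ * Real.pi * a) ^ 2) : ℝ) :
            ℂ) := by
  have hexp (x : ℕ → ℝ) : Complex.exp (2 * (Real.pi : ℂ) * Complex.I * (a : ℂ) *
        ((∑ n ∈ Finset.range N, ((3 : ℝ)⁻¹) ^ (n + 1) * x (n + 1) : ℝ) : ℂ))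
      = ∏ i : Fin N, Complex.exp (2 * Complex.I *
          (((3 : ℝ) ^ ((i : ℕ) + 1))⁻¹ * Real.pi * a : ℝ) * x (i + 1)) := by
    rw [Finset.sum_range, ← Complex.exp_sum]
    push_cast
    rw [Finset.mul_sum]
    congr 1
    refine Finset.sum_congr rfl fun i _ => ?_
    rw [inv_pow]
    ring
  simp_rw [hexp]
  have hindep := hζ.iIndepFun_eval.precomp (Fin.val_injective (n := N))
  rw [hindep.integral_fun_prod_comp
    (f := fun (i : Fin N) (t : ℝ) => Complex.exp (2 * Complex.I *
      (((3 : ℝ) ^ ((i : ℕ) + 1))⁻¹ * Real.pi * a : ℝ) * t))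
    (fun i => (measurable_pi_apply _).aemeasurable)
    (fun i => Continuous.aestronglyMeasurable (by fun_prop)), Finset.prod_range,
    Complex.ofReal_prod]
  refine Finset.prod_congr rfl fun i _ => ?_
  have h := integral_cexp_cantorFactor (hp (i + 1) (Nat.le_add_left 1 _))
    (((3 : ℝ) ^ ((i : ℕ) + 1))⁻¹ * Real.pi * a)
  rw [← hζ.map_eval (Nat.le_add_left 1 _), integral_map (measurable_pi_apply _).aemeasurable
    (Continuous.aestronglyMeasurable (by fun_prop))] at h
  exact h

/-- For every `a ∈ ℝ`,
`∫ e^{2πiat} dν(t) = ∏_{m=1}^∞ (1 - 2(1-p_m) sin²(3^{-m} π a))`, and the infinite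
product converges. -/
theorem fourier_transform_cantor_measure
    (p : ℕ → ℝ) (hp : ∀ n, 1 ≤ n → 0 ≤ p n ∧ p n ≤ 1)
    (ζ : Measure (ℕ → ℝ)) (hζ : IsCantorProductMeasure p ζ)
    (ν : Measure ℝ) (hν : ν = ζ.map cantorCoord) (a : ℝ) :
    Multipliable (fun m : ℕ =>
        1 - 2 * (1 - p (m + 1)) * Real.sin (((3 : ℝ) ^ (m + 1))⁻¹ * Real.pi * a) ^ 2) ∧
    ∫ t, Complex.exp (2 * (Real.pi : ℂ) * Complex.I * (a : ℂ) * (t : ℂ)) ∂ν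
      = ((∏' m : ℕ,
          (1 - 2 * (1 - p (m + 1)) * Real.sin (((3 : ℝ) ^ (m + 1))⁻¹ * Real.pi * a) ^ 2) : ℝ) : ℂ) := by
  have hmul := multipliable_one_sub_sin_sq hp a
  refine ⟨hmul, ?_⟩
  have := hζ.1
  rw [hν, integral_map hζ.aemeasurable_cantorCoord
    (Continuous.aestronglyMeasurable (by fun_prop))]
  have hlim := (Complex.continuous_ofReal.tendsto _).comp hmul.hasProd.tendsto_prod_nat
  refine tendsto_nhds_unique ?_ hlim
  simp only [Function.comp_def, ← hζ.integral_cexp_sum hp a]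
  refine tendsto_integral_of_dominated_convergence (fun _ => 1)
    (fun N => Measurable.aestronglyMeasurable (by fun_prop)) (integrable_const _)
    (fun N => ae_of_all _ fun x => ?_) ?_
  · rw [Complex.norm_exp]
    rw [Real.exp_le_one_iff]
    simp only [Complex.mul_re, Complex.mul_im, Complex.ofReal_re, Complex.ofReal_im]
    simp
  · filter_upwards [hζ.ae_abs_le_one] with x hx
    have hcont : Continuous fun t : ℝ =>
        Complex.exp (2 * (Real.pi : ℂ) * Complex.I * (a : ℂ) * (t : ℂ)) := by fun_prop
    exact (hcont.tendsto _).comp (tendsto_sum_cantorCoord hx)
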